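/- For all β₁, β₂ ∈ Φ with β₁^ω ≠ 0 and β₂^ω ≠ 0: s_{β₁^ω}(β₂^ω) ∈ Φ_re^ω. Consequently s_v(Φ_re^ω) = Φ_re^ω for every v ∈ Φ_re^ω. -/

import Mathlib

open scoped RealInnerProductSpace

namespace Folding

variable {E : Type*} [NormedAddCommGroup E] [InnerProductSpace ℝ E]

/-- The coroot `α^∨ = 2α/(α,α)` of a nonzero vector `α`. -/
noncomputable def coroot (α : E) : E := (2 / ⟪α, α⟫) • α

/-- The reflection `s_α(x) = x - (α^∨, x) α`. -/
noncomputable def reflVec (α x : E) : E := x - ⟪coroot α, x⟫ • α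

/-- `Φ` is a (finite, not necessarily reduced) root system in `E`. -/
def IsRootSystem (Φ : Set E) : Prop :=
  Φ.Finite ∧ (0 : E) ∉ Φ ∧ Submodule.span ℝ Φ = ⊤ ∧
    (∀ α ∈ Φ, ∀ β ∈ Φ, reflVec α β ∈ Φ) ∧
    ∀ α ∈ Φ, ∀ β ∈ Φ, ∃ n : ℤ, ⟪coroot α, β⟫ = (n : ℝ)

/-- `Φ` is reduced: no root is half of another root. -/
def IsReducedRS (Φ : Set E) : Prop := ∀ α ∈ Φ, (2⁻¹ : ℝ) • α ∉ Φ

/-- `Φ` is irreducible: nonempty and not a disjoint union of two nonempty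
mutually orthogonal subsets. -/
def IsIrreducibleRS (Φ : Set E) : Prop :=
  Φ.Nonempty ∧
    ¬∃ Φ₁ Φ₂ : Set E, Φ₁.Nonempty ∧ Φ₂.Nonempty ∧ Φ₁ ∪ Φ₂ = Φ ∧ Disjoint Φ₁ Φ₂ ∧
      ∀ u ∈ Φ₁, ∀ v ∈ Φ₂, ⟪u, v⟫ = 0

/-- `Δ` is a basis (a set of simple roots) of the root system `Φ`:
it is a vector space basis of `E`, and every root is a linear combination of `Δ`
whose coefficients are all nonnegative integers or all nonpositive integers. -/
def IsBaseRS (Φ : Set E) (Δ : Finset E) : Prop :=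
  ↑Δ ⊆ Φ ∧ LinearIndependent ℝ (fun α : {x : E // x ∈ Δ} => (α : E)) ∧
    Submodule.span ℝ (Δ : Set E) = ⊤ ∧
    ∀ β ∈ Φ, ∃ c : E → ℤ, ((∀ α, 0 ≤ c α) ∨ (∀ α, c α ≤ 0)) ∧
      β = ∑ α ∈ Δ, (c α : ℝ) • α

/-- `ω` belongs to the Weyl group of `Φ`: it is a product of reflections in roots. -/
def InWeylGroup (Φ : Set E) (ω : E ≃ₗᵢ[ℝ] E) : Prop :=
  ∃ l : List E, (∀ α ∈ l, α ∈ Φ) ∧ ∀ x : E, ω x = l.foldr reflVec x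

/-- The average `x^ω = (1/o(ω)) Σ_{t=1}^{o(ω)} ω^t(x)`, where `o(ω)` is the order of `ω`. -/
noncomputable def avg (ω : E ≃ₗᵢ[ℝ] E) (x : E) : E :=
  (orderOf ω : ℝ)⁻¹ • ∑ t ∈ Finset.range (orderOf ω), (ω ^ (t + 1)) x

/-- The fixed-point set `E^ω`. -/
def fixedSet (ω : E ≃ₗᵢ[ℝ] E) : Set E := {x | ω x = x}

/-- The fixed-point subspace `E^ω`. -/
def fixedSubmodule (ω : E ≃ₗᵢ[ℝ] E) : Submodule ℝ E :=
  LinearMap.ker ((ω.toLinearEquiv : E →ₗ[ℝ] E) - LinearMap.id)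

/-- The folded root system `Φ_re^ω = {β^ω : β ∈ Φ, β^ω ≠ 0}`. -/
noncomputable def foldedRoots (Φ : Set E) (ω : E ≃ₗᵢ[ℝ] E) : Set E :=
  {v | v ≠ 0 ∧ ∃ β ∈ Φ, avg ω β = v}

/-- The `⟨ω⟩`-orbit `O(β) = {ω^t(β) : t ∈ ℤ}`. -/
def orbitOf (ω : E ≃ₗᵢ[ℝ] E) (β : E) : Set E := {γ | ∃ t : ℤ, (ω ^ t) β = γ}

/-- `N(β) = {γ ∈ O(β) : γ ≠ ±β, (β,γ) ≠ 0}`. -/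
def nbrOf (ω : E ≃ₗᵢ[ℝ] E) (β : E) : Set E :=
  {γ | γ ∈ orbitOf ω β ∧ γ ≠ β ∧ γ ≠ -β ∧ ⟪β, γ⟫ ≠ 0}


/-- `Δ^ω`: the averages of the simple roots whose `⟨ω⟩`-orbit avoids `α₀ = -htilde`. -/
noncomputable def simpleAvg (Δ : Finset E) (htilde : E) (ω : E ≃ₗᵢ[ℝ] E) : Set E :=
  {v | ∃ α ∈ (Δ : Set E), -htilde ∉ orbitOf ω α ∧ avg ω α = v}

/-- `π̄_S = (Σ_{α ∈ S} ϖ_α^∨)^ω` for a subset `S` of `Δ₀`. -/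
noncomputable def pibar (ω : E ≃ₗᵢ[ℝ] E) (ϖ : E → E) (S : Set E) : E :=
  avg ω (∑ᶠ γ ∈ S, ϖ γ)

end Folding


open Folding

namespace Folding

variable {E : Type*} [NormedAddCommGroup E] [InnerProductSpace ℝ E]

lemma inner_coroot (α x : E) : ⟪coroot α, x⟫ = 2 / ⟪α, α⟫ * ⟪α, x⟫ := by
  rw [coroot, real_inner_smul_left]

lemma reflVec_zero (v : E) : reflVec v 0 = 0 := by
  simp [reflVec]

lemma reflVec_reflVec {v : E} (hv : v ≠ 0) (x : E) : reflVec v (reflVec v x) = x := by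
  have h : ⟪v, v⟫ ≠ 0 := inner_self_ne_zero.2 hv
  simp only [reflVec, inner_coroot, inner_sub_right, real_inner_smul_right]
  match_scalars
  · ring
  · field_simp
    ring

lemma reflVec_self {v : E} (hv : v ≠ 0) : reflVec v v = -v := by
  have h : ⟪v, v⟫ ≠ 0 := inner_self_ne_zero.2 hv
  simp only [reflVec, inner_coroot]
  match_scalars
  field_simp
  ring

lemma reflVec_smul {c : ℝ} (hc : c ≠ 0) (v x : E) : reflVec (c • v) x = reflVec v x := by
  simp only [reflVec, inner_coroot, real_inner_smul_left, real_inner_smul_right]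
  rw [smul_smul]
  congr 2
  by_cases h : ⟪v, v⟫ = 0
  · simp [inner_self_eq_zero.1 h]
  · field_simp

lemma IsRootSystem.neg_mem {Φ : Set E} (hΦ : IsRootSystem Φ) {β : E} (hβ : β ∈ Φ) : -β ∈ Φ := by
  have h0 : β ≠ 0 := fun h => hΦ.2.1 (h ▸ hβ)
  exact reflVec_self h0 ▸ hΦ.2.2.2.1 β hβ β hβ

lemma InWeylGroup.map_mem {Φ : Set E} (hΦ : IsRootSystem Φ) {ω : E ≃ₗᵢ[ℝ] E}
    (hω : InWeylGroup Φ ω) {β : E} (hβ : β ∈ Φ) : ω β ∈ Φ := by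
  obtain ⟨l, hl, h⟩ := hω
  rw [h]
  clear h
  induction l with
  | nil => exact hβ
  | cons a l ih =>
    simp only [List.mem_cons, forall_eq_or_imp] at hl
    exact hΦ.2.2.2.1 _ hl.1 _ (ih hl.2)

lemma InWeylGroup.pow_map_mem {Φ : Set E} (hΦ : IsRootSystem Φ) {ω : E ≃ₗᵢ[ℝ] E}
    (hω : InWeylGroup Φ ω) {β : E} (hβ : β ∈ Φ) (t : ℕ) : (ω ^ t) β ∈ Φ := by
  induction t with
  | zero => simpa using hβ
  | succ t ih =>
    rw [pow_succ']
    exact hω.map_mem hΦ ih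

/-- Two distinct roots of equal length with positive inner product differ by a root. -/
lemma IsRootSystem.sub_mem {Φ : Set E} (hΦ : IsRootSystem Φ) {β γ : E} (hβ : β ∈ Φ) (hγ : γ ∈ Φ)
    (hn : ⟪γ, γ⟫ = ⟪β, β⟫) (hne : γ ≠ β) (hpos : 0 < ⟪β, γ⟫) : γ - β ∈ Φ := by
  have h0 : β ≠ 0 := fun h => hΦ.2.1 (h ▸ hβ)
  have hb : 0 < ⟪β, β⟫ := real_inner_self_pos.2 h0
  have hlt : ⟪β, γ⟫ < ⟪β, β⟫ := by
    have h1 : 0 < ⟪γ - β, γ - β⟫ := real_inner_self_pos.2 (sub_ne_zero.2 hne)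
    rw [real_inner_sub_sub_self, real_inner_comm β γ] at h1
    linarith
  obtain ⟨n, h⟩ := hΦ.2.2.2.2 β hβ γ hγ
  have hr := hΦ.2.2.2.1 β hβ γ hγ
  rw [reflVec, h] at hr
  rw [inner_coroot] at h
  have h1 : (n : ℝ) * ⟪β, β⟫ = 2 * ⟪β, γ⟫ := by
    rw [← h]
    field_simp
  have hn0 : 0 < n := by
    by_contra! hc
    have : (n : ℝ) ≤ 0 := by exact_mod_cast hc
    nlinarith
  have hn2 : n < 2 := by
    by_contra! hc
    have : (2 : ℝ) ≤ n := by exact_mod_cast hc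
    nlinarith
  obtain rfl : n = 1 := by omega
  simpa using hr

/-- The composite of the reflections in pairwise orthogonal roots preserves the root system. -/
lemma IsRootSystem.sub_sum_mem {Φ : Set E} (hΦ : IsRootSystem Φ) (s : Finset E)
    (hs : ∀ α ∈ s, α ∈ Φ) (hort : ∀ α ∈ s, ∀ γ ∈ s, α ≠ γ → ⟪α, γ⟫ = 0) {x : E} (hx : x ∈ Φ) :
    x - ∑ α ∈ s, ⟪coroot α, x⟫ • α ∈ Φ := by
  classical
  induction s using Finset.induction_on with
  | empty => simpa using hx
  | insert a s ha ih =>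
    have h1 := ih (fun α h => hs α (Finset.mem_insert_of_mem h)) (fun α h γ h' =>
      hort α (Finset.mem_insert_of_mem h) γ (Finset.mem_insert_of_mem h'))
    have h2 := hΦ.2.2.2.1 a (hs a (Finset.mem_insert_self _ _)) _ h1
    have h3 : ⟪coroot a, ∑ α ∈ s, ⟪coroot α, x⟫ • α⟫ = 0 := by
      rw [inner_sum]
      refine Finset.sum_eq_zero fun α hα => ?_
      rw [real_inner_smul_right, inner_coroot a, hort a (Finset.mem_insert_self _ _) α
        (Finset.mem_insert_of_mem hα) (fun h => ha (h ▸ hα))]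
      simp
    rw [reflVec, inner_sub_right, h3, sub_zero] at h2
    rw [Finset.sum_insert ha]
    convert h2 using 1
    abel

section avg

variable (ω : E ≃ₗᵢ[ℝ] E)

lemma avg_sub (x y : E) : avg ω (x - y) = avg ω x - avg ω y := by
  simp [avg, smul_sub]

lemma avg_add (x y : E) : avg ω (x + y) = avg ω x + avg ω y := by
  simp [avg, Finset.sum_add_distrib]

lemma avg_smul (c : ℝ) (x : E) : avg ω (c • x) = c • avg ω x := by
  simp only [avg, map_smul, ← Finset.smul_sum]
  rw [smul_comm]

lemma avg_neg (x : E) : avg ω (-x) = -avg ω x := by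
  simp [avg]

lemma avg_sum {ι : Type*} (s : Finset ι) (g : ι → E) :
    avg ω (∑ i ∈ s, g i) = ∑ i ∈ s, avg ω (g i) := by
  simp only [avg, map_sum, ← Finset.smul_sum]
  rw [Finset.sum_comm]

lemma map_avg (x : E) : ω (avg ω x) = avg ω x := by
  have h := Finset.sum_range_succ' (fun t => (ω ^ (t + 1)) x) (orderOf ω)
  rw [Finset.sum_range_succ, pow_succ, pow_orderOf_eq_one, one_mul, zero_add, pow_one] at h
  have h' := add_right_cancel h
  simp only [avg, map_smul, map_sum]
  rw [h']
  congr 1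
  refine Finset.sum_congr rfl fun t _ => ?_
  rw [pow_succ' ω (t + 1)]
  rfl

lemma avg_map (x : E) : avg ω (ω x) = avg ω x := by
  rw [← map_avg ω x]
  simp only [avg, map_smul, map_sum]
  congr 1
  refine Finset.sum_congr rfl fun t _ => ?_
  change (ω ^ (t + 1) * ω) x = (ω * ω ^ (t + 1)) x
  rw [← pow_succ, ← pow_succ']

lemma avg_pow_map (t : ℕ) (x : E) : avg ω ((ω ^ t) x) = avg ω x := by
  induction t with
  | zero => simp
  | succ t ih =>
    rw [pow_succ']
    exact (avg_map ω _).trans ih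

lemma pow_map_of_fixed {x : E} (hx : ω x = x) (t : ℕ) : (ω ^ t) x = x := by
  induction t with
  | zero => simp
  | succ t ih =>
    rw [pow_succ]
    change (ω ^ t) (ω x) = x
    rw [hx, ih]

variable {ω}

lemma orderOf_ne_zero_of_avg_ne_zero {x : E} (hx : avg ω x ≠ 0) : orderOf ω ≠ 0 := by
  intro h
  exact hx (by simp [avg, h])

lemma avg_of_fixed (hm : orderOf ω ≠ 0) {x : E} (hx : ω x = x) : avg ω x = x := by
  simp only [avg, pow_map_of_fixed ω hx, Finset.sum_const, Finset.card_range]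
  rw [← Nat.cast_smul_eq_nsmul ℝ, smul_smul, inv_mul_cancel₀ (by exact_mod_cast hm), one_smul]

lemma inner_avg_of_fixed (hm : orderOf ω ≠ 0) {v : E} (hv : ω v = v) (x : E) :
    ⟪v, avg ω x⟫ = ⟪v, x⟫ := by
  have h (t : ℕ) : ⟪v, (ω ^ t) x⟫ = ⟪v, x⟫ := by
    conv_lhs => rw [← pow_map_of_fixed ω hv t]
    exact (ω ^ t).inner_map_map v x
  simp only [avg, real_inner_smul_right, inner_sum, h, Finset.sum_const, Finset.card_range,
    nsmul_eq_mul]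
  rw [← mul_assoc, inv_mul_cancel₀ (by exact_mod_cast hm), one_mul]

end avg

/-- If the `⟨ω⟩`-orbit of a root `β` is orthogonal, then the reflection in `avg ω β` sends
averages of roots to averages of roots. -/
lemma exists_avg_eq_reflVec {Φ : Set E} (hΦ : IsRootSystem Φ) {ω : E ≃ₗᵢ[ℝ] E}
    (hω : InWeylGroup Φ ω) {β γ : E} (hβ : β ∈ Φ) (hγ : γ ∈ Φ) (hb : avg ω β ≠ 0)
    (hort : ∀ t : ℕ, (ω ^ t) β ≠ β → ⟪β, (ω ^ t) β⟫ = 0) :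
    ∃ δ ∈ Φ, avg ω δ = reflVec (avg ω β) (avg ω γ) := by
  classical
  have hm := orderOf_ne_zero_of_avg_ne_zero hb
  have hβ0 : β ≠ 0 := fun h => hΦ.2.1 (h ▸ hβ)
  set O : Finset E := (Finset.range (orderOf ω)).image fun t => (ω ^ t) β with hO
  have hmem (t : ℕ) : (ω ^ t) β ∈ O := by
    rw [hO, Finset.mem_image]
    exact ⟨t % orderOf ω, Finset.mem_range.2 (Nat.mod_lt _ (Nat.pos_of_ne_zero hm)),
      by rw [pow_mod_orderOf]⟩
  have hex {α : E} (h : α ∈ O) : ∃ t : ℕ, (ω ^ t) β = α := by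
    obtain ⟨t, -, ht⟩ := Finset.mem_image.1 h
    exact ⟨t, ht⟩
  have hnorm {α : E} (h : α ∈ O) : ⟪α, α⟫ = ⟪β, β⟫ := by
    obtain ⟨t, rfl⟩ := hex h
    exact (ω ^ t).inner_map_map β β
  have hOort : ∀ α ∈ O, ∀ α' ∈ O, α ≠ α' → ⟪α, α'⟫ = 0 := by
    have key (s u : ℕ) (hne : (ω ^ s) β ≠ (ω ^ (s + u)) β) :
        ⟪(ω ^ s) β, (ω ^ (s + u)) β⟫ = 0 := by
      rw [pow_add] at hne ⊢
      change ⟪(ω ^ s) β, (ω ^ s) ((ω ^ u) β)⟫ = 0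
      rw [(ω ^ s).inner_map_map]
      exact hort u fun h => hne (congrArg (ω ^ s) h).symm
    intro α hα α' hα' hne
    obtain ⟨s, rfl⟩ := hex hα
    obtain ⟨u, rfl⟩ := hex hα'
    rcases le_total s u with h | h
    · obtain ⟨k, rfl⟩ := Nat.exists_eq_add_of_le h
      exact key s k hne
    · obtain ⟨k, rfl⟩ := Nat.exists_eq_add_of_le h
      rw [real_inner_comm]
      exact key u k hne.symm
  have himg : O.image ω = O := by
    refine Finset.eq_of_subset_of_card_le ?_ (Finset.card_image_of_injective _ ω.injective).ge
    intro α hα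
    obtain ⟨α', h, rfl⟩ := Finset.mem_image.1 hα
    obtain ⟨t, rfl⟩ := hex h
    have := hmem (t + 1)
    rwa [pow_succ'] at this
  have hsumfix : ω (∑ α ∈ O, α) = ∑ α ∈ O, α := by
    rw [map_sum]
    conv_rhs => rw [← himg]
    rw [Finset.sum_image ω.injective.injOn]
  have havg {α : E} (h : α ∈ O) : avg ω α = avg ω β := by
    obtain ⟨t, rfl⟩ := hex h
    exact avg_pow_map ω t β
  have hsum : ∑ α ∈ O, α = (O.card : ℝ) • avg ω β := by
    rw [← avg_of_fixed hm hsumfix, avg_sum, Finset.sum_congr rfl fun α h => havg h,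
      Finset.sum_const, Nat.cast_smul_eq_nsmul]
  have hββ : ⟪β, β⟫ = (O.card : ℝ) * ⟪avg ω β, avg ω β⟫ := by
    have hβO : β ∈ O := by simpa using hmem 0
    have h1 : ⟪∑ α ∈ O, α, β⟫ = ⟪β, β⟫ := by
      rw [sum_inner]
      exact Finset.sum_eq_single_of_mem β hβO fun α hα hne => hOort α hα β hβO hne
    rw [← h1, hsum, real_inner_smul_left, inner_avg_of_fixed hm (map_avg ω β)]
  have hOΦ : ∀ α ∈ O, α ∈ Φ := by
    intro α hα
    obtain ⟨t, rfl⟩ := hex hα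
    exact hω.pow_map_mem hΦ hβ t
  refine ⟨_, hΦ.sub_sum_mem O hOΦ hOort hγ, ?_⟩
  have hpos : ⟪β, β⟫ ≠ 0 := inner_self_ne_zero.2 hβ0
  have hcoef : ∑ α ∈ O, ⟪coroot α, γ⟫ = ⟪coroot (avg ω β), avg ω γ⟫ := by
    have h1 : ∑ α ∈ O, ⟪coroot α, γ⟫ = 2 / ⟪β, β⟫ * ⟪∑ α ∈ O, α, γ⟫ := by
      rw [sum_inner, Finset.mul_sum]
      exact Finset.sum_congr rfl fun α hα => by rw [inner_coroot, hnorm hα]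
    rw [h1, hsum, real_inner_smul_left, inner_coroot, inner_avg_of_fixed hm (map_avg ω β) γ, hββ]
    have hc : (O.card : ℝ) ≠ 0 := fun h => hpos (by rw [hββ, h, zero_mul])
    have hv : ⟪avg ω β, avg ω β⟫ ≠ 0 := inner_self_ne_zero.2 hb
    field_simp
  rw [avg_sub, avg_sum, Finset.sum_congr rfl fun α h => by rw [avg_smul, havg h],
    ← Finset.sum_smul, hcoef, reflVec]

/-- There is a linear functional taking the value `1` on every simple root. -/
lemma IsBaseRS.exists_height {Φ : Set E} {Δ : Finset E} (hΔ : IsBaseRS Φ Δ) :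
    ∃ L : E →ₗ[ℝ] ℝ, ∀ α ∈ Δ, L α = 1 := by
  obtain ⟨-, hli, hsp, -⟩ := hΔ
  let b : Module.Basis {x : E // x ∈ Δ} ℝ E := Module.Basis.mk hli (by
    rw [Subtype.range_coe_subtype]
    exact hsp.ge)
  refine ⟨b.constr ℝ fun _ => 1, fun α hα => ?_⟩
  have h := b.constr_basis ℝ (fun _ => (1 : ℝ)) ⟨α, hα⟩
  rwa [Module.Basis.mk_apply] at h

/-- The difference of two distinct elements of an `⟨ω⟩`-orbit of roots is not a root: modulo the
Coxeter number, the height is `ω`-invariant, while it is nonzero on every root. -/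
lemma pow_map_sub_notMem {Φ : Set E} {Δ : Finset E} {coeff : E → E → ℝ} {htilde : E}
    {ω : E ≃ₗᵢ[ℝ] E} (hΦ : IsRootSystem Φ) (hΔ : IsBaseRS Φ Δ)
    (hcoeff : ∀ β ∈ Φ, β = ∑ α ∈ Δ, coeff β α • α) (hht : htilde ∈ Φ)
    (hhighest : ∀ β ∈ Φ, β ≠ htilde → ∑ α ∈ Δ, coeff β α < ∑ α ∈ Δ, coeff htilde α)
    (hω : InWeylGroup Φ ω) (hωΔ₀ : ⇑ω '' (↑Δ ∪ {-htilde}) = ↑Δ ∪ {-htilde})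
    {β : E} (hβ : β ∈ Φ) (t : ℕ) : (ω ^ t) β - β ∉ Φ := by
  obtain ⟨L, hL⟩ := hΔ.exists_height
  have hLsum (c : E → ℝ) : L (∑ α ∈ Δ, c α • α) = ∑ α ∈ Δ, c α := by
    rw [map_sum]
    exact Finset.sum_congr rfl fun α hα => by simp [hL α hα]
  have hLcoeff {δ : E} (hδ : δ ∈ Φ) : L δ = ∑ α ∈ Δ, coeff δ α := by
    conv_lhs => rw [hcoeff δ hδ]
    exact hLsum _
  have hle {δ : E} (hδ : δ ∈ Φ) : L δ ≤ L htilde := by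
    rcases eq_or_ne δ htilde with rfl | h
    · exact le_rfl
    · rw [hLcoeff hδ, hLcoeff hht]
      exact (hhighest δ hδ h).le
  have hne {δ : E} (hδ : δ ∈ Φ) : L δ ≠ 0 := by
    intro h0
    obtain ⟨c, hc, hδc⟩ := hΔ.2.2.2 δ hδ
    rw [hδc, hLsum fun α => (c α : ℝ)] at h0
    have hz : ∀ α ∈ Δ, (c α : ℝ) = 0 := by
      rcases hc with hc | hc
      · exact (Finset.sum_eq_zero_iff_of_nonneg fun α _ => by exact_mod_cast hc α).1 h0
      · exact (Finset.sum_eq_zero_iff_of_nonpos fun α _ => by exact_mod_cast hc α).1 h0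
    have hδ0 : δ = 0 :=
      hδc.trans (Finset.sum_eq_zero fun α hα => by rw [hz α hα, zero_smul])
    exact hΦ.2.1 (hδ0 ▸ hδ)
  have hmap {δ : E} (hδ : δ ∈ Φ) : ∃ n : ℤ, L (ω δ) = L δ + n * (L htilde + 1) := by
    have h1 : ∀ α : E, ∃ n : ℤ, α ∈ Δ → L (ω α) = 1 + n * (L htilde + 1) := by
      intro α
      by_cases hα : α ∈ Δ
      · have hmem : ω α ∈ (↑Δ ∪ {-htilde} : Set E) := hωΔ₀ ▸ ⟨α, Or.inl hα, rfl⟩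
        rcases hmem with h | h
        · exact ⟨0, fun _ => by simp [hL _ h]⟩
        · refine ⟨-1, fun _ => ?_⟩
          rw [Set.mem_singleton_iff.1 h, map_neg]
          push_cast
          ring
      · exact ⟨0, fun h => absurd h hα⟩
    choose n hn using h1
    obtain ⟨c, -, hδc⟩ := hΔ.2.2.2 δ hδ
    refine ⟨∑ α ∈ Δ, c α * n α, ?_⟩
    conv_lhs => rw [hδc]
    conv_rhs => rw [hδc]
    rw [hLsum fun α => (c α : ℝ)]
    simp only [map_sum, map_smul, smul_eq_mul]
    push_cast
    rw [Finset.sum_mul, ← Finset.sum_add_distrib]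
    refine Finset.sum_congr rfl fun α hα => ?_
    rw [hn α hα]
    ring
  have hpow : ∃ n : ℤ, L ((ω ^ t) β) = L β + n * (L htilde + 1) := by
    induction t with
    | zero => exact ⟨0, by simp⟩
    | succ t ih =>
      obtain ⟨n, hn⟩ := ih
      obtain ⟨k, hk⟩ := hmap (hω.pow_map_mem hΦ hβ t)
      refine ⟨n + k, ?_⟩
      rw [pow_succ']
      change L (ω ((ω ^ t) β)) = _
      rw [hk, hn]
      push_cast
      ring
  intro hmem
  obtain ⟨n, hn⟩ := hpow
  have h1 := hle hmem
  have h2 := hle (hΦ.neg_mem hmem)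
  have h3 := hne hmem
  rw [map_neg] at h2
  rw [map_sub, hn, add_sub_cancel_left] at h1 h2 h3
  rcases lt_trichotomy n 0 with h | rfl | h
  · have : (n : ℝ) ≤ -1 := by exact_mod_cast Int.le_sub_one_of_lt h
    nlinarith
  · simp at h3
  · have : (1 : ℝ) ≤ n := by exact_mod_cast h
    nlinarith

/-- Every line spanned by a folded root contains the average of a root with orthogonal orbit. -/
lemma exists_orthogonal_orbit {Φ : Set E} {ω : E ≃ₗᵢ[ℝ] E} (hΦ : IsRootSystem Φ)
    (hω : InWeylGroup Φ ω) (hsub : ∀ β ∈ Φ, ∀ t : ℕ, (ω ^ t) β - β ∉ Φ)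
    {β : E} (hβ : β ∈ Φ) (hb : avg ω β ≠ 0) :
    ∃ δ ∈ Φ, (∃ c : ℝ, c ≠ 0 ∧ avg ω δ = c • avg ω β) ∧
      ∀ t : ℕ, (ω ^ t) δ ≠ δ → ⟪δ, (ω ^ t) δ⟫ = 0 := by
  obtain ⟨δ, ⟨hδ, c, hc, hδc⟩, hmax⟩ := Set.exists_max_image
    {δ | δ ∈ Φ ∧ ∃ c : ℝ, c ≠ 0 ∧ avg ω δ = c • avg ω β} (fun δ => ‖avg ω δ‖)
    (hΦ.1.subset fun _ h => h.1) ⟨β, hβ, 1, one_ne_zero, (one_smul ℝ _).symm⟩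
  refine ⟨δ, hδ, ⟨c, hc, hδc⟩, fun t hne => ?_⟩
  have hd : avg ω δ ≠ 0 := hδc ▸ smul_ne_zero hc hb
  have htδ := hω.pow_map_mem hΦ hδ t
  have hn : ⟪(ω ^ t) δ, (ω ^ t) δ⟫ = ⟪δ, δ⟫ := (ω ^ t).inner_map_map δ δ
  rcases lt_trichotomy ⟪δ, (ω ^ t) δ⟫ 0 with h | h | h
  · exfalso
    have hne' : (ω ^ t) δ ≠ -δ := by
      intro h'
      have h1 := avg_pow_map ω t δ
      rw [h', avg_neg] at h1
      have h2 : (2 : ℝ) • avg ω δ = 0 := by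
        rw [two_smul, add_eq_zero_iff_neg_eq, h1]
      exact hd ((smul_eq_zero.1 h2).resolve_left two_ne_zero)
    have hsum := hΦ.sub_mem (hΦ.neg_mem hδ) htδ (by rw [inner_neg_neg, hn]) hne'
      (by rw [inner_neg_left]; linarith)
    rw [sub_neg_eq_add] at hsum
    have h2 : avg ω ((ω ^ t) δ + δ) = (2 : ℝ) • avg ω δ := by
      rw [avg_add, avg_pow_map, two_smul]
    have h3 := hmax _ ⟨hsum, 2 * c, by simpa using hc, by rw [h2, hδc, smul_smul]⟩
    simp only [h2, norm_smul, Real.norm_ofNat] at h3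
    have := norm_pos_iff.2 hd
    linarith
  · exact h
  · exact absurd (hΦ.sub_mem hδ htδ hn hne h) (hsub δ hδ t)

end Folding

theorem reflection_preserves_folded
    {E : Type*} [NormedAddCommGroup E] [InnerProductSpace ℝ E] [FiniteDimensional ℝ E]
    (Φ : Set E) (Δ : Finset E) (coeff : E → E → ℝ) (htilde : E) (ω : E ≃ₗᵢ[ℝ] E)
    (hΦrs : IsRootSystem Φ) (hΦred : IsReducedRS Φ) (hΦirr : IsIrreducibleRS Φ)
    (hΔ : IsBaseRS Φ Δ)
    (hcoeff : ∀ β ∈ Φ, β = ∑ α ∈ Δ, coeff β α • α)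
    (hht : htilde ∈ Φ)
    (hhighest : ∀ β ∈ Φ, β ≠ htilde → ∑ α ∈ Δ, coeff β α < ∑ α ∈ Δ, coeff htilde α)
    (hωW : InWeylGroup Φ ω)
    (hωΔ₀ : ⇑ω '' (↑Δ ∪ {-htilde}) = ↑Δ ∪ {-htilde}) :
    (∀ β₁ ∈ Φ, ∀ β₂ ∈ Φ, avg ω β₁ ≠ 0 → avg ω β₂ ≠ 0 →
      reflVec (avg ω β₁) (avg ω β₂) ∈ foldedRoots Φ ω) ∧
    ∀ v ∈ foldedRoots Φ ω, reflVec v '' foldedRoots Φ ω = foldedRoots Φ ω := by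
  have hfirst : ∀ β₁ ∈ Φ, ∀ β₂ ∈ Φ, avg ω β₁ ≠ 0 → avg ω β₂ ≠ 0 →
      reflVec (avg ω β₁) (avg ω β₂) ∈ foldedRoots Φ ω := by
    intro β₁ h₁ β₂ h₂ hn₁ hn₂
    obtain ⟨δ, hδ, ⟨c, hc, hδc⟩, hort⟩ := exists_orthogonal_orbit hΦrs hωW
      (fun β hβ t => pow_map_sub_notMem hΦrs hΔ hcoeff hht hhighest hωW hωΔ₀ hβ t) h₁ hn₁
    obtain ⟨ε, hε, h⟩ := exists_avg_eq_reflVec hΦrs hωW hδ h₂ (hδc ▸ smul_ne_zero hc hn₁) hort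
    rw [hδc, reflVec_smul hc] at h
    refine ⟨fun h0 => hn₂ ?_, ε, hε, h⟩
    rw [← reflVec_reflVec hn₁ (avg ω β₂), h0, reflVec_zero]
  refine ⟨hfirst, ?_⟩
  rintro _ ⟨hv, β₁, h₁, rfl⟩
  have hsub : ∀ u ∈ foldedRoots Φ ω, reflVec (avg ω β₁) u ∈ foldedRoots Φ ω := by
    rintro _ ⟨hu, β₂, h₂, rfl⟩
    exact hfirst β₁ h₁ β₂ h₂ hv hu
  exact Set.Subset.antisymm (Set.image_subset_iff.2 hsub)
    fun u hu => ⟨_, hsub u hu, reflVec_reflVec hv u⟩
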